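/- Let Φ be an NQBF₂,∀ formula with n universally quantified variables and 3CNF matrix φ with m clauses, let BS(Φ) be the associated graph game, and let x be the imputation assigning m to sat, n−1 to chall, and 0 to every other player. Then no player of BS(Φ) different from chall has a justified objection to x against the player sat. -/

import Mathlib

set_option synthInstance.maxSize 1000
set_option maxHeartbeats 1000000

/-!
The graph game `BS(Φ)` associated with an `NQBF₂,∀` formula
`Φ = (∀α)(∃β) φ(α, β)`, where `α = {α₁, …, α_n}` are the universally quantified variables,
`β = {β₁, …, β_r}` the existentially quantified ones, and `φ = c₁ ∧ … ∧ c_m` is a 3CNF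
formula in which each universal variable `α_k` occurs only in the two clauses
`c_{i(k)} = (α_k ∨ ¬β_k)` and `c_{ī(k)} = (¬α_k ∨ β_k)`.

A variable is an element of `Fin n ⊕ Fin r` (`Sum.inl` = universal, `Sum.inr` =
existential); a literal is a variable together with a sign (`true` = positive); a clause
is the finset of its literals, so `φ` is given by
`c : Fin m → Finset ((Fin n ⊕ Fin r) × Bool)`.
-/

/-- The variables of the matrix of `Φ`. -/
abbrev BVar (n r : ℕ) := Fin n ⊕ Fin r

/-- Literal occurrences: a literal together with a clause it occurs in. -/
abbrev BLit (n r m : ℕ) (c : Fin m → Finset (BVar n r × Bool)) :=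
  {p : (BVar n r × Bool) × Fin m // p.1 ∈ c p.2}

/-- The players of the graph game `BS(Φ)`: clause players, literal players, and the
special players `chall` (encoded by `false`) and `sat` (encoded by `true`). -/
abbrev BP (n r m : ℕ) (c : Fin m → Finset (BVar n r × Bool)) :=
  Fin m ⊕ (BLit n r m c ⊕ Bool)

variable {n r m : ℕ} (c : Fin m → Finset (BVar n r × Bool))

/-- The clause player `c_j`. -/
def BPcl (j : Fin m) : BP n r m c := Sum.inl j
/-- The literal player `ℓ_{i,j}`. -/
def BPlit (l : BLit n r m c) : BP n r m c := Sum.inr (Sum.inl l)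
/-- The player `chall`. -/
def BPchall : BP n r m c := Sum.inr (Sum.inr false)
/-- The player `sat`. -/
def BPsat : BP n r m c := Sum.inr (Sum.inr true)

/-- The (symmetric) edge-weight function of `BS(Φ)`, excluding the normalizer edge
`{chall, sat}`; `Bw0 c u v = 0` when `{u, v}` is not an edge.
Positive edges, of weight `1`: `{c_j, ℓ_{i,j}}` for each literal occurrence and
`{chall, ℓ_{i,j}}` for each occurrence of a literal over a universally quantified
variable.  Penalty edges, of weight `−m−1`: pairs of distinct literal occurrences in the
same clause, opposite occurrences of the same variable, `{chall, ℓ_{i,j}}` for each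
occurrence of a literal over an existentially quantified variable, and `{chall, c_j}`
for each clause. -/
noncomputable def Bw0 : BP n r m c → BP n r m c → ℝ := fun u v =>
  match u, v with
  | Sum.inl j, Sum.inr (Sum.inl l) => if l.1.2 = j then 1 else 0
  | Sum.inr (Sum.inl l), Sum.inl j => if l.1.2 = j then 1 else 0
  | Sum.inr (Sum.inr false), Sum.inr (Sum.inl l) =>
      (match l.1.1.1 with
       | Sum.inl _ => 1
       | Sum.inr _ => -((m:ℝ)+1))
  | Sum.inr (Sum.inl l), Sum.inr (Sum.inr false) =>
      (match l.1.1.1 with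
       | Sum.inl _ => 1
       | Sum.inr _ => -((m:ℝ)+1))
  | Sum.inr (Sum.inl l), Sum.inr (Sum.inl l') =>
      if (l.1.2 = l'.1.2 ∧ l.1.1 ≠ l'.1.1) ∨ (l.1.1.1 = l'.1.1.1 ∧ l.1.1.2 ≠ l'.1.1.2)
      then -((m:ℝ)+1) else 0
  | Sum.inr (Sum.inr false), Sum.inl _ => -((m:ℝ)+1)
  | Sum.inl _, Sum.inr (Sum.inr false) => -((m:ℝ)+1)
  | _, _ => 0

/-- The weight of the normalizer edge `{chall, sat}`:
`n − 1 + m` minus the sum of the weights of all other edges. -/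
noncomputable def Bwnorm : ℝ :=
  (n : ℝ) - 1 + (m : ℝ) - (∑ u : BP n r m c, ∑ v : BP n r m c, Bw0 c u v) / 2

/-- The full (symmetric) edge-weight function of `BS(Φ)`. -/
noncomputable def Bw (u v : BP n r m c) : ℝ :=
  Bw0 c u v +
    (if (u = BPchall c ∧ v = BPsat c) ∨ (u = BPsat c ∧ v = BPchall c) then Bwnorm c else 0)

/-- The worth of a coalition `S` in the graph game `BS(Φ)`: the sum of the weights of all
edges contained in `S` (written via the symmetric weight function). -/
noncomputable def Bworth (S : Finset (BP n r m c)) : ℝ := (∑ u ∈ S, ∑ v ∈ S, Bw c u v) / 2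

/-- The payoff vector assigning `m` to `sat`, `n − 1` to `chall`, and `0` to every other
player. -/
noncomputable def Bx : BP n r m c → ℝ := fun p =>
  if p = BPsat c then (m : ℝ) else if p = BPchall c then (n : ℝ) - 1 else 0

/-- `x` is an imputation: efficient and individually rational. -/
def BIsImputation (x : BP n r m c → ℝ) : Prop :=
  (∑ p, x p) = Bworth c Finset.univ ∧ ∀ p, x p ≥ Bworth c {p}

/-- `(y, S)` is an objection of player `i` against player `j` to the payoff vector `x`. -/
def BObjection (x : BP n r m c → ℝ) (i j : BP n r m c)
    (S : Finset (BP n r m c)) (y : BP n r m c → ℝ) : Prop :=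
  i ∈ S ∧ j ∉ S ∧ (∑ k ∈ S, y k) = Bworth c S ∧ ∀ k ∈ S, y k > x k

/-- `(z, T)` is a counterobjection to the objection `(y, S)` of `i` against `j` to `x`. -/
def BCounter (x : BP n r m c → ℝ) (i j : BP n r m c)
    (S : Finset (BP n r m c)) (y : BP n r m c → ℝ)
    (T : Finset (BP n r m c)) (z : BP n r m c → ℝ) : Prop :=
  j ∈ T ∧ i ∉ T ∧ (∑ k ∈ T, z k) = Bworth c T ∧
    (∀ k ∈ T \ S, z k ≥ x k) ∧ (∀ k ∈ T ∩ S, z k ≥ y k)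

/-- `(y, S)` is a justified objection of `i` against `j` to `x`: an objection admitting
no counterobjection. -/
def BJustified (x : BP n r m c → ℝ) (i j : BP n r m c)
    (S : Finset (BP n r m c)) (y : BP n r m c → ℝ) : Prop :=
  BObjection c x i j S y ∧ ∀ T z, ¬ BCounter c x i j S y T z

/-- Validity of the `NQBF₂,∀` formula `Φ`: for every assignment of the universally
quantified variables there is an assignment of the existentially quantified variables
satisfying every clause of the matrix. -/
def BValid : Prop :=
  ∀ a : Fin n → Bool, ∃ bb : Fin r → Bool,
    ∀ j : Fin m, ∃ l ∈ c j, Sum.elim a bb l.1 = l.2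

/-- The clause containing the literal of sign `b` over the `k`-th universal variable. -/
def clauseOf {n m : ℕ} (ci cbar : Fin n → Fin m) (p : Fin n × Bool) : Fin m :=
  if p.2 = true then ci p.1 else cbar p.1

/-- The literal occurrences over universally quantified variables. -/
def univLits : Finset (BLit n r m c) := Finset.univ.filter fun l => l.1.1.1.isLeft = true

/-- The literal occurrences over existentially quantified variables. -/
def exLits : Finset (BLit n r m c) := Finset.univ.filter fun l => ¬ l.1.1.1.isLeft = true

lemma clause_clauseOf {n r m : ℕ} (hnr : n ≤ r)
    (c : Fin m → Finset (BVar n r × Bool)) (ci cbar : Fin n → Fin m)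
    (hci : ∀ k : Fin n,
      c (ci k) = {((Sum.inl k : BVar n r), true),
                  ((Sum.inr (Fin.castLE hnr k) : BVar n r), false)})
    (hcbar : ∀ k : Fin n,
      c (cbar k) = {((Sum.inl k : BVar n r), false),
                    ((Sum.inr (Fin.castLE hnr k) : BVar n r), true)})
    (p : Fin n × Bool) :
    c (clauseOf ci cbar p) = {((Sum.inl p.1 : BVar n r), p.2),
      ((Sum.inr (Fin.castLE hnr p.1) : BVar n r), !p.2)} := by
  obtain ⟨k, b⟩ := p
  cases b
  · simpa [clauseOf] using hcbar k
  · simpa [clauseOf] using hci k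

section Counting

variable {hnr : n ≤ r} {c} {d : Fin n × Bool → Fin m}

lemma clause_injective
    (hd : ∀ p, c (d p) = {((Sum.inl p.1 : BVar n r), p.2),
      ((Sum.inr (Fin.castLE hnr p.1) : BVar n r), !p.2)}) : Function.Injective d := by
  intro p q h
  have hp : ((Sum.inl p.1 : BVar n r), p.2) ∈ c (d p) := by simp [hd p]
  rw [h, hd q] at hp
  simpa [Prod.ext_iff] using hp

lemma two_mul_le_clauses
    (hd : ∀ p, c (d p) = {((Sum.inl p.1 : BVar n r), p.2),
      ((Sum.inr (Fin.castLE hnr p.1) : BVar n r), !p.2)}) : 2 * n ≤ m := by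
  have h := Fintype.card_le_of_injective d (clause_injective hd)
  simp only [Fintype.card_prod, Fintype.card_fin, Fintype.card_bool] at h
  omega

lemma two_mul_le_card_exLits
    (hd : ∀ p, c (d p) = {((Sum.inl p.1 : BVar n r), p.2),
      ((Sum.inr (Fin.castLE hnr p.1) : BVar n r), !p.2)}) :
    2 * n ≤ (exLits c).card := by
  let f : Fin n × Bool → BLit n r m c := fun p =>
    ⟨(((Sum.inr (Fin.castLE hnr p.1) : BVar n r), !p.2), d p), by simp [hd p]⟩
  have hf : Function.Injective f := fun p q h =>
    clause_injective hd (congrArg (fun l : BLit n r m c => l.1.2) h)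
  have h := Finset.card_le_card_of_injOn (s := Finset.univ) (t := exLits c) f
    (by intro p _; simp [exLits, f]) hf.injOn
  simp only [Finset.card_univ, Fintype.card_prod, Fintype.card_fin, Fintype.card_bool] at h
  omega

lemma card_univLits_le
    (h : ∀ p j, ((Sum.inl p.1 : BVar n r), p.2) ∈ c j → j = d p) :
    (univLits c).card ≤ 2 * n := by
  let f : Fin n × Bool → (BVar n r × Bool) × Fin m := fun p => ((Sum.inl p.1, p.2), d p)
  have hsub : (univLits c).map (Function.Embedding.subtype _) ⊆ Finset.univ.image f := by
    intro q hq
    simp only [Finset.mem_map, univLits, Finset.mem_filter, Finset.mem_univ, true_and] at hq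
    obtain ⟨⟨⟨⟨v, b⟩, j⟩, hl⟩, hv, rfl⟩ := hq
    rcases v with k | k
    · exact Finset.mem_image.2 ⟨(k, b), Finset.mem_univ _, Prod.ext rfl (h (k, b) j hl).symm⟩
    · simp at hv
  have h1 := (Finset.card_le_card hsub).trans Finset.card_image_le
  simp only [Finset.card_map, Finset.card_univ, Fintype.card_prod, Fintype.card_fin,
    Fintype.card_bool] at h1
  omega

end Counting

lemma sum_lits_ite (a b : ℝ) :
    (∑ l : BLit n r m c, if l.1.1.1.isLeft = true then a else b) =
      (univLits c).card * a + (exLits c).card * b := by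
  rw [Finset.sum_ite]
  simp [univLits, exLits]

/-- A symmetric weight on pairs of players that only involves edges joining a clause player
to a literal player, a literal player to `chall`, or a clause player to `chall`. -/
def starWeight (a b e : ℝ) : BP n r m c → BP n r m c → ℝ := fun u v =>
  match u, v with
  | Sum.inl j, Sum.inr (Sum.inl l) => if l.1.2 = j then 1 else 0
  | Sum.inr (Sum.inl l), Sum.inl j => if l.1.2 = j then 1 else 0
  | Sum.inr (Sum.inr false), Sum.inr (Sum.inl l) => if l.1.1.1.isLeft = true then a else b
  | Sum.inr (Sum.inl l), Sum.inr (Sum.inr false) => if l.1.1.1.isLeft = true then a else b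
  | Sum.inr (Sum.inr false), Sum.inl _ => e
  | Sum.inl _, Sum.inr (Sum.inr false) => e
  | _, _ => 0

lemma sum_starWeight (a b e : ℝ) :
    (∑ u, ∑ v, starWeight c a b e u v) / 2 =
      (univLits c).card * (1 + a) + (exLits c).card * (1 + b) + m * e := by
  have h : (∑ j : Fin m, ∑ l : BLit n r m c, if l.1.2 = j then (1 : ℝ) else 0) =
      (univLits c).card * 1 + (exLits c).card * 1 := by
    rw [← sum_lits_ite, Finset.sum_comm]
    simp
  have h' : (∑ l : BLit n r m c, ∑ j : Fin m, if l.1.2 = j then (1 : ℝ) else 0) =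
      (univLits c).card * 1 + (exLits c).card * 1 := by
    rw [← h, Finset.sum_comm]
  simp only [Fintype.sum_sum_type, Fintype.sum_bool, starWeight, Finset.sum_add_distrib,
    Finset.sum_const_zero, h, h', sum_lits_ite, Finset.sum_const, Finset.card_univ,
    Fintype.card_fin, nsmul_eq_mul]
  ring

lemma Bw0_le_starWeight (u v : BP n r m c) :
    Bw0 c u v ≤ starWeight c 1 (-((m : ℝ) + 1)) (-((m : ℝ) + 1)) u v := by
  have hm : (0 : ℝ) ≤ m := Nat.cast_nonneg m
  rcases u with j | ⟨⟨⟨⟨k | k, b⟩, j⟩, hl⟩ | _ | _⟩ <;>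
    rcases v with j' | ⟨⟨⟨⟨k' | k', b'⟩, j'⟩, hl'⟩ | _ | _⟩ <;>
    simp only [Bw0, starWeight, Sum.isLeft, if_true, Bool.false_eq_true, if_false, le_refl] <;>
    split_ifs <;> linarith

lemma starWeight_le_starWeight {b b' e e' : ℝ} (a : ℝ) (hb : b ≤ b') (he : e ≤ e')
    (u v : BP n r m c) : starWeight c a b e u v ≤ starWeight c a b' e' u v := by
  rcases u with j | l | _ | _ <;> rcases v with j' | l' | _ | _ <;>
    simp only [starWeight, le_refl, he] <;> split_ifs <;> simp [hb]

lemma starWeight_nonneg {a b e : ℝ} (ha : 0 ≤ a) (hb : 0 ≤ b) (he : 0 ≤ e)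
    (u v : BP n r m c) : 0 ≤ starWeight c a b e u v := by
  rcases u with j | l | _ | _ <;> rcases v with j' | l' | _ | _ <;>
    simp only [starWeight, le_refl, he] <;> split_ifs <;> simp [ha, hb]

lemma le_Bwnorm :
    (n : ℝ) - 1 + m - ((univLits c).card * 2 - (exLits c).card * m - m * (m + 1)) ≤
      Bwnorm c := by
  have h := sum_starWeight c 1 (-((m : ℝ) + 1)) (-((m : ℝ) + 1))
  have h' : (∑ u, ∑ v, Bw0 c u v) ≤
      ∑ u, ∑ v, starWeight c 1 (-((m : ℝ) + 1)) (-((m : ℝ) + 1)) u v :=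
    Finset.sum_le_sum fun u _ => Finset.sum_le_sum fun v _ => Bw0_le_starWeight c u v
  unfold Bwnorm
  linarith

lemma Bworth_le_of_sat_notMem {S : Finset (BP n r m c)} (hS : BPsat c ∉ S) :
    Bworth c S ≤ (univLits c).card * 2 + (exLits c).card := by
  have h := sum_starWeight c 1 0 0
  have hm : -((m : ℝ) + 1) ≤ 0 := by
    have : (0 : ℝ) ≤ m := Nat.cast_nonneg m
    linarith
  have hnn := starWeight_nonneg c zero_le_one le_rfl le_rfl
  have h1 : (∑ u ∈ S, ∑ v ∈ S, Bw c u v) ≤ ∑ u ∈ S, ∑ v ∈ S, starWeight c 1 0 0 u v := by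
    refine Finset.sum_le_sum fun u hu => Finset.sum_le_sum fun v hv => ?_
    have hu' : u ≠ BPsat c := fun e => hS (e ▸ hu)
    have hv' : v ≠ BPsat c := fun e => hS (e ▸ hv)
    have := (Bw0_le_starWeight c u v).trans (starWeight_le_starWeight c 1 hm hm u v)
    simpa [Bw, hu', hv'] using this
  have h2 : (∑ u ∈ S, ∑ v ∈ S, starWeight c 1 0 0 u v) ≤ ∑ u, ∑ v, starWeight c 1 0 0 u v :=
    (Finset.sum_le_sum fun u _ => Finset.sum_le_univ_sum_of_nonneg (hnn u)).trans
      (Finset.sum_le_univ_sum_of_nonneg fun u => Finset.sum_nonneg fun v _ => hnn u v)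
  unfold Bworth
  linarith

lemma BPsat_ne_BPchall : BPsat c ≠ BPchall c := by simp [BPsat, BPchall]

lemma Bworth_sat_chall : Bworth c {BPsat c, BPchall c} = Bwnorm c := by
  rw [Bworth, Finset.sum_pair (BPsat_ne_BPchall c), Finset.sum_pair (BPsat_ne_BPchall c),
    Finset.sum_pair (BPsat_ne_BPchall c)]
  simp [Bw, Bw0, BPsat, BPchall]

/-- If `{chall, sat}` is worth enough to pay `m` to `sat` and whatever `chall` can claim, then
it yields a counterobjection. -/
lemma exists_BCounter_of_le {i : BP n r m c} {S : Finset (BP n r m c)} {y : BP n r m c → ℝ}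
    (hi : i ≠ BPchall c) (hiS : i ∈ S) (hS : BPsat c ∉ S)
    (h : (m : ℝ) + (if BPchall c ∈ S then y (BPchall c) else n - 1) ≤ Bwnorm c) :
    ∃ T z, BCounter c (Bx c) i (BPsat c) S y T z := by
  have hne := BPsat_ne_BPchall c
  have his : i ≠ BPsat c := fun e => hS (e ▸ hiS)
  let q : ℝ := if BPchall c ∈ S then y (BPchall c) else n - 1
  refine ⟨{BPsat c, BPchall c}, fun k => if k = BPchall c then q else Bwnorm c - q,
    by simp, by simp [hi, his], ?_, ?_, ?_⟩
  · rw [Bworth_sat_chall, Finset.sum_pair hne]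
    simp [hne]
  · intro k hk
    simp only [Finset.mem_sdiff, Finset.mem_insert, Finset.mem_singleton] at hk
    obtain ⟨rfl | rfl, hk⟩ := hk
    · simp only [hne, if_false, Bx, if_true, ge_iff_le]
      change _ + q ≤ _ at h
      linarith
    · simp [Bx, hne.symm, q, hk]
  · intro k hk
    simp only [Finset.mem_inter, Finset.mem_insert, Finset.mem_singleton] at hk
    obtain ⟨rfl | rfl, hk⟩ := hk
    · exact absurd hk hS
    · simp [q, hk]

lemma BObjection.le_Bworth {i : BP n r m c} {S : Finset (BP n r m c)} {y : BP n r m c → ℝ}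
    (h : BObjection c (Bx c) i (BPsat c) S y) (hc : BPchall c ∈ S) :
    y (BPchall c) ≤ Bworth c S := by
  obtain ⟨-, -, hy, hx⟩ := h
  rw [← hy, ← Finset.add_sum_erase S y hc]
  refine le_add_of_nonneg_right (Finset.sum_nonneg fun k hk => ?_)
  obtain ⟨hk, hkS⟩ := Finset.mem_erase.1 hk
  refine le_trans ?_ (hx k hkS).le
  simp only [Bx, hk, if_false]
  split_ifs <;> simp

/--
**No justified objection against `sat` except possibly by `chall`.**
Let `Φ` be an `NQBF₂,∀` formula, `BS(Φ)` the associated graph game, and `x` the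
imputation assigning `m` to `sat`, `n − 1` to `chall`, and `0` to every other player.
Then no player of `BS(Φ)` different from `chall` has a justified objection to `x`
against the player `sat`.
-/
theorem BS_no_justified_objection_against_sat (n r m : ℕ) (hnr : n ≤ r)
    (c : Fin m → Finset (BVar n r × Bool)) (ci cbar : Fin n → Fin m)
    (h3 : ∀ j, (c j).card ≤ 3)
    (hci : ∀ k : Fin n,
      c (ci k) = {((Sum.inl k : BVar n r), true),
                  ((Sum.inr (Fin.castLE hnr k) : BVar n r), false)})
    (hcbar : ∀ k : Fin n,
      c (cbar k) = {((Sum.inl k : BVar n r), false),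
                    ((Sum.inr (Fin.castLE hnr k) : BVar n r), true)})
    (honly : ∀ (k : Fin n) (j : Fin m) (b : Bool),
      ((Sum.inl k : BVar n r), b) ∈ c j → j = (if b = true then ci k else cbar k)) :
    ∀ (i : BP n r m c), i ≠ BPchall c →
      ∀ (S : Finset (BP n r m c)) (y : BP n r m c → ℝ),
        ¬ BJustified c (Bx c) i (BPsat c) S y := by
  have hd := clause_clauseOf hnr c ci cbar hci hcbar
  have hm := two_mul_le_clauses hd
  have hE := two_mul_le_card_exLits hd
  have hU : (univLits c).card ≤ 2 * n :=
    card_univLits_le (d := clauseOf ci cbar) fun p j h => honly p.1 j p.2 h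
  intro i hi S y ⟨hobj, hno⟩
  obtain ⟨hiS, hS, -, -⟩ := id hobj
  have hm1 : 1 ≤ m := by
    rcases i with j | l | _ | _
    · exact j.pos
    · exact l.1.2.pos
    · exact absurd rfl hi
    · exact absurd hiS hS
  obtain ⟨T, z, hT⟩ : ∃ T z, BCounter c (Bx c) i (BPsat c) S y T z := by
    refine exists_BCounter_of_le c hi hiS hS (le_trans ?_ (le_Bwnorm c))
    have hm' : 2 * (n : ℝ) ≤ m := by exact_mod_cast hm
    have hE' : 2 * (n : ℝ) ≤ (exLits c).card := by exact_mod_cast hE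
    have hU' : ((univLits c).card : ℝ) ≤ 2 * n := by exact_mod_cast hU
    have hm1' : (1 : ℝ) ≤ m := by exact_mod_cast hm1
    have hn0 : (0 : ℝ) ≤ n := Nat.cast_nonneg n
    split_ifs with hc
    · have hy := (hobj.le_Bworth c hc).trans (Bworth_le_of_sat_notMem c hS)
      have key : 7 * (n : ℝ) + 1 ≤ 2 * n * (m - 1) + m * (m + 1) := by
        rcases Nat.eq_zero_or_pos n with h0 | h0
        · simp only [h0, Nat.cast_zero]
          nlinarith
        · have h0' : (1 : ℝ) ≤ n := by exact_mod_cast h0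
          nlinarith
      nlinarith [mul_le_mul_of_nonneg_right hE' (sub_nonneg.2 hm1')]
    · nlinarith
  exact hno T z hT
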